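/- (Truth Lemma) Let M be a countable transitive set with (M,∈) ⊨ ZF, let ⟨P,≼,𝟙⟩ ∈ M be a forcing notion, let φ be an L-formula with arity(φ) ≤ n, let τ₁,…,τₙ ∈ M, and let G be an M-generic filter on P. Then (M[G],∈) ⊨ φ[val(G,τ₁),…,val(G,τₙ)] if and only if there exists p ∈ G such that for every M-generic filter H with p ∈ H, (M[H],∈) ⊨ φ[val(H,τ₁),…,val(H,τₙ)]. -/

import Mathlib

namespace CtmForcing

open FirstOrder FirstOrder.Language

/-! ### The first-order language of set theory -/

/-- The relation symbols of the language of set theory: a single binary relation `∈`. -/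
inductive memRel : ℕ → Type
  | mem : memRel 2

/-- The first-order language `L` of set theory, with a single binary relation symbol `∈`. -/
def SetLang : Language := ⟨fun _ => Empty, memRel⟩

/-- The membership relation symbol. -/
abbrev memSymb : SetLang.Relations 2 := .mem

/-- `L`-formulas (with no free "unbounded" variables) whose free variables are among
`v₀, …, v_{n-1}`. -/
abbrev BF (n : ℕ) := SetLang.BoundedFormula Empty n

/-- The atomic formula `vᵢ ∈ vⱼ`. -/
def memf {n : ℕ} (i j : Fin n) : BF n :=
  memSymb.boundedFormula₂ (Term.var (Sum.inr i)) (Term.var (Sum.inr j))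

/-- The atomic formula `vᵢ = vⱼ`. -/
def eqf {n : ℕ} (i j : Fin n) : BF n :=
  Term.bdEqual (Term.var (Sum.inr i)) (Term.var (Sum.inr j))

/-- Rename the free variables of a formula along `f`. -/
def reindex {m k : ℕ} (f : Fin m → Fin k) (φ : BF m) : BF k :=
  (BoundedFormula.relabel (Sum.map id f) φ.toFormula : SetLang.BoundedFormula Empty (k + 0))

/-- Conjunction. -/
def andF {n : ℕ} (φ ψ : BF n) : BF n := (φ.imp ψ.not).not

/-- Disjunction. -/
def orF {n : ℕ} (φ ψ : BF n) : BF n := (φ.not).imp ψ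

/-- Biimplication. -/
def iffF {n : ℕ} (φ ψ : BF n) : BF n := andF (φ.imp ψ) (ψ.imp φ)

/-! ### Basic set-theoretic formulas -/

/-- `v₀ ⊆ v₁`. -/
def subF : BF 2 := ((memf 2 0).imp (memf 2 1)).all

/-- `v₀ = ∅`. -/
def emptyF : BF 1 := ((memf 1 0).not).all

/-- `v₂ = {v₀, v₁}`. -/
def pairSetF : BF 3 := (iffF (memf 3 2) (orF (eqf 3 0) (eqf 3 1))).all

/-- `v₁ = {v₀}`. -/
def singF : BF 2 := reindex ![0, 0, 1] pairSetF

/-- `v₂ = ⟨v₀, v₁⟩` (Kuratowski ordered pair). -/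
def opF : BF 3 :=
  (iffF (memf 3 2) (orF (reindex ![0, 3] singF) (reindex ![0, 1, 3] pairSetF))).all

/-- `v₁ = v₀ ∪ {v₀}`. -/
def succF : BF 2 := (iffF (memf 2 1) (orF (memf 2 0) (eqf 2 0))).all

/-- `v₀` is transitive. -/
def transF : BF 1 := ((memf 1 0).imp (reindex ![1, 0] subF)).all

/-- `v₀` is an ordinal (a transitive set of transitive sets). -/
def ordF : BF 1 := andF transF (((memf 1 0).imp (reindex ![1] transF)).all)

/-- `⟨v₀, v₁⟩ ∈ v₂`. -/
def relMemF : BF 3 := (andF (reindex ![0, 1, 3] opF) (memf 3 2)).ex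

/-- `v₂` is a function with domain `v₀` mapping onto `v₁` (a surjection from `v₀` onto `v₁`). -/
def isFuncF : BF 3 :=
  andF
    (andF
      -- v₂ ⊆ v₀ × v₁
      (((memf 3 2).imp
        (((andF (andF (memf 4 0) (memf 5 1)) (reindex ![4, 5, 3] opF)).ex).ex)).all)
      -- total on v₀
      (((memf 3 0).imp ((andF (memf 4 1) (reindex ![3, 4, 2] relMemF)).ex)).all))
    (andF
      -- functional
      ((((andF (reindex ![3, 4, 2] relMemF) (reindex ![3, 5, 2] relMemF)).imp
          (eqf 4 5)).all).all.all)
      -- onto v₁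
      (((memf 3 1).imp ((andF (memf 4 0) (reindex ![4, 3, 2] relMemF)).ex)).all))

/-- `v₂` is injective (as a set of ordered pairs). -/
def injF : BF 3 :=
  ((((andF (reindex ![3, 5, 2] relMemF) (reindex ![4, 5, 2] relMemF)).imp
      (eqf 3 4)).all).all).all

/-- `v₂` is a bijection from `v₀` onto `v₁`. -/
def bijF : BF 3 := andF isFuncF injF

/-! ### The axioms of set theory as `L`-sentences -/

/-- Extensionality. -/
def extAx : SetLang.Sentence :=
  ((((andF subF (reindex ![1, 0] subF)).imp (eqf 0 1)).all).all : BF 0)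

/-- Foundation. -/
def foundAx : SetLang.Sentence :=
  (((((memf 1 0).ex).imp
    ((andF (memf 1 0) (((memf 2 0).imp ((memf 2 1).not)).all)).ex)).all) : BF 0)

/-- Pairing. -/
def pairAx : SetLang.Sentence := (((pairSetF.ex).all).all : BF 0)

/-- Union. -/
def unionAx : SetLang.Sentence :=
  (((((iffF (memf 2 1) ((andF (memf 3 0) (memf 2 3)).ex)).all).ex).all : BF 0))

/-- Powerset. -/
def powF : BF 2 := (iffF (memf 2 1) (reindex ![2, 0] subF)).all

/-- Powerset axiom. -/
def powAx : SetLang.Sentence := (((powF.ex).all) : BF 0)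

/-- Infinity. -/
def infAx : SetLang.Sentence :=
  (((andF ((andF (memf 1 0) (reindex ![1] emptyF)).ex)
    (((memf 1 0).imp ((andF (memf 2 0) (reindex ![1, 2] succF)).ex)).all)).ex) : BF 0)

/-- The instance of the Separation scheme given by `φ`, whose free variables are among
`v₀, …, vₙ`: the parameters are `v₀, …, v_{n-1}` and the tested element is `vₙ`.  It is the
universal closure of `∀A ∃B ∀x (x ∈ B ↔ x ∈ A ∧ φ(params, x))`. -/
def sepAx {n : ℕ} (φ : BF (n + 1)) : SetLang.Sentence :=
  -- context `n+3`: parameters `0,…,n-1`, `A = n`, `B = n+1`, `x = n+2`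
  let A : Fin (n + 3) := ⟨n, by omega⟩
  let B : Fin (n + 3) := ⟨n + 1, by omega⟩
  let x : Fin (n + 3) := ⟨n + 2, by omega⟩
  let φ' : BF (n + 3) := reindex (fun i => if h : (i : ℕ) < n then ⟨i, by omega⟩ else x) φ
  ((((iffF (memf x B) (andF (memf x A) φ')).all).ex).all).alls

/-- The instance of the Replacement scheme given by `φ`, whose free variables are among
`v₀, …, v_{n+1}`: the parameters are `v₀, …, v_{n-1}`, the argument is `x = vₙ`, and the
value is `y = v_{n+1}`.  It is the universal closure of
`∀A [(∀x∈A ∀y ∀y' (φ(x,y) ∧ φ(x,y') → y = y')) → ∃B ∀y (y ∈ B ↔ ∃x∈A φ(x,y))]`. -/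
def replAx {n : ℕ} (φ : BF (n + 2)) : SetLang.Sentence :=
  -- functionality context `n+4`: parameters, `A = n`, `x = n+1`, `y = n+2`, `y' = n+3`
  let A : Fin (n + 4) := ⟨n, by omega⟩
  let x : Fin (n + 4) := ⟨n + 1, by omega⟩
  let y : Fin (n + 4) := ⟨n + 2, by omega⟩
  let y' : Fin (n + 4) := ⟨n + 3, by omega⟩
  let φ₁ : BF (n + 4) :=
    reindex (fun i => if h : (i : ℕ) < n then ⟨i, by omega⟩ else if (i : ℕ) = n then x else y) φ
  let φ₂ : BF (n + 4) :=
    reindex (fun i => if h : (i : ℕ) < n then ⟨i, by omega⟩ else if (i : ℕ) = n then x else y') φ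
  let funcl : BF (n + 1) :=
    ((((andF (memf x A) (andF φ₁ φ₂)).imp (eqf y y')).all).all).all
  -- image context `n+4`: parameters, `A = n`, `B = n+1`, `y = n+2`, `x = n+3`
  let xi : Fin (n + 4) := ⟨n + 3, by omega⟩
  let yi : Fin (n + 4) := ⟨n + 2, by omega⟩
  let B3 : Fin (n + 3) := ⟨n + 1, by omega⟩
  let y3 : Fin (n + 3) := ⟨n + 2, by omega⟩
  let φ₃ : BF (n + 4) :=
    reindex (fun i => if h : (i : ℕ) < n then ⟨i, by omega⟩ else if (i : ℕ) = n then xi else yi) φ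
  let image : BF (n + 1) :=
    (((iffF (memf y3 B3) ((andF (memf xi A) φ₃).ex)).all).ex)
  ((funcl.imp image).all).alls

/-- The Axiom of Choice: every set is the surjective image of an ordinal. -/
def acAx : SetLang.Sentence :=
  ((((andF (reindex ![1] ordF) (reindex ![1, 0, 2] isFuncF)).ex).ex).all : BF 0)

/-- `v₀ = ω`: `v₀` is an ordinal containing `∅`, closed under successors, each of whose
elements is `∅` or a successor. -/
def omegaF : BF 1 :=
  andF (andF ordF ((andF (memf 1 0) (reindex ![1] emptyF)).ex))
    (andF (((memf 1 0).imp ((andF (memf 2 0) (reindex ![1, 2] succF)).ex)).all)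
      (((memf 1 0).imp
        (orF (reindex ![1] emptyF) ((andF (memf 2 1) (reindex ![2, 1] succF)).ex))).all))

/-- Given `v₀ = ω`, `v₁ = ℵ₁`: `v₁` is an ordinal, there is no surjection from `ω` onto `v₁`,
and every element of `v₁` is empty or a surjective image of `ω`. -/
def alephOneF : BF 2 :=
  andF (andF (reindex ![1] ordF) (((reindex ![0, 1, 2] isFuncF).ex).not))
    (((memf 2 1).imp (orF (reindex ![2] emptyF) ((reindex ![0, 2, 3] isFuncF).ex))).all)

/-- The Continuum Hypothesis `ℵ₁ = 2^ℵ₀`: there is a bijection between `𝒫(ω)` and `ℵ₁`. -/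
def chSent : SetLang.Sentence :=
  (((((andF (andF (reindex ![0] omegaF) (reindex ![0, 1] powF))
      (andF (reindex ![0, 2] alephOneF) (reindex ![1, 2, 3] bijF))).ex).ex).ex).ex : BF 0)

/-! ### The theories `Z`, `ZF`, `ZC`, `ZFC` -/

/-- The finitely many non-scheme axioms of `ZF`. -/
def zfFin : SetLang.Theory := {extAx, foundAx, pairAx, unionAx, powAx, infAx}

/-- All instances of the Separation scheme. -/
def sepScheme : SetLang.Theory := Set.range fun p : Σ n, BF (n + 1) => sepAx p.2

/-- All instances of the Replacement scheme. -/
def replScheme : SetLang.Theory := Set.range fun p : Σ n, BF (n + 2) => replAx p.2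

/-- Zermelo set theory. -/
def Z : SetLang.Theory := zfFin ∪ sepScheme

/-- Zermelo–Fraenkel set theory. -/
def ZF : SetLang.Theory := Z ∪ replScheme

/-- Zermelo set theory with Choice. -/
def ZC : SetLang.Theory := Z ∪ {acAx}

/-- Zermelo–Fraenkel set theory with Choice. -/
def ZFC : SetLang.Theory := ZF ∪ {acAx}

/-! ### Satisfaction in a set with the true membership relation -/

/-- The `L`-structure on (the elements of) a `ZFSet` `M`, with `∈` interpreted as true
membership. -/
def zfStruct (M : ZFSet) : SetLang.Structure {x : ZFSet // x ∈ M} where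
  funMap := fun f _ => f.elim
  RelMap | .mem => fun v => ((v 0 : {x : ZFSet // x ∈ M}) : ZFSet) ∈ ((v 1 : {x : ZFSet // x ∈ M}) : ZFSet)

/-- `(M, ∈) ⊨ T`: the structure on `M` with true membership satisfies every sentence of `T`. -/
def ZModels (M : ZFSet) (T : SetLang.Theory) : Prop :=
  ∀ φ ∈ T, letI := zfStruct M; Sentence.Realize (M := {x : ZFSet // x ∈ M}) φ

/-- `(M, ∈) ⊨ φ[v₀, …, v_{k-1}]`: satisfaction of the formula `φ` in `M`, with the
(membership-checked) valuation `v` of its free variables. -/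
def ZRealize (M : ZFSet) {k : ℕ} (φ : BF k) (v : Fin k → ZFSet) : Prop :=
  ∀ h : ∀ i, v i ∈ M,
    letI := zfStruct M
    BoundedFormula.Realize (M := {x : ZFSet // x ∈ M}) φ (fun e => e.elim) (fun i => ⟨v i, h i⟩)

/-- `x` is a (von Neumann) ordinal: a transitive set of transitive sets. -/
def IsOrd (x : ZFSet) : Prop := x.IsTransitive ∧ ∀ y ∈ x, ZFSet.IsTransitive y


/-! ### Forcing: names, values, generic extensions -/

/-- The value `val(G, τ)` of a name `τ` under `G`, defined by `∈`-recursion: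
`val(G, τ) = { val(G, σ) : ∃ p ∈ G, ⟨σ, p⟩ ∈ τ }`. -/
noncomputable def zval (G : ZFSet) : ZFSet → ZFSet :=
  (InvImage.wf ZFSet.rank Ordinal.lt_wf).fix fun τ ih =>
    letI : ∀ (n : ℕ) (f : (Fin n → ZFSet) → ZFSet), ZFSet.Definable n f := fun _ _ => Classical.allZFSetDefinable _
    ZFSet.image (fun σ => if h : ZFSet.rank σ < ZFSet.rank τ then ih σ h else ∅)
      (ZFSet.sep (fun σ => ∃ p ∈ G, ZFSet.pair σ p ∈ τ) (ZFSet.sUnion (ZFSet.sUnion τ)))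

/-- The generic extension `M[G] = { val(G, τ) : τ ∈ M }`. -/
noncomputable def genExt (M G : ZFSet) : ZFSet :=
  letI : ∀ (n : ℕ) (f : (Fin n → ZFSet) → ZFSet), ZFSet.Definable n f := fun _ _ => Classical.allZFSetDefinable _
  ZFSet.image (zval G) M

/-- `⟨P, r, one⟩` is a forcing notion belonging to `M`: `r ∈ M` is (the graph of) a preorder
on `P ∈ M` with greatest element `one`. -/
def ForcingNotion (M P r one : ZFSet) : Prop :=
  P ∈ M ∧ r ∈ M ∧ one ∈ P ∧
    (∀ q ∈ r, ∃ a ∈ P, ∃ b ∈ P, q = ZFSet.pair a b) ∧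
    (∀ p ∈ P, ZFSet.pair p p ∈ r) ∧
    (∀ p ∈ P, ∀ q ∈ P, ∀ s ∈ P, ZFSet.pair p q ∈ r → ZFSet.pair q s ∈ r →
      ZFSet.pair p s ∈ r) ∧
    (∀ p ∈ P, ZFSet.pair p one ∈ r)

/-- `D` is a dense subset of the forcing notion `⟨P, r⟩`. -/
def IsDenseIn (r P D : ZFSet) : Prop :=
  D ⊆ P ∧ ∀ p ∈ P, ∃ d ∈ D, ZFSet.pair d p ∈ r

/-- `G` is a filter on `⟨P, r⟩`: upward closed and downward directed. -/
def IsFilterOn (r P G : ZFSet) : Prop :=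
  G ⊆ P ∧ (∀ x ∈ G, ∀ y ∈ P, ZFSet.pair x y ∈ r → y ∈ G) ∧
    (∀ x ∈ G, ∀ y ∈ G, ∃ z ∈ G, ZFSet.pair z x ∈ r ∧ ZFSet.pair z y ∈ r)

/-- `G` is an `M`-generic filter on `⟨P, r⟩`: a filter meeting every dense subset of `P`
that belongs to `M`. -/
def IsGeneric (M r P G : ZFSet) : Prop :=
  IsFilterOn r P G ∧ ∀ D ∈ M, IsDenseIn r P D → ∃ q ∈ G, q ∈ D



/-! ### Definability framework -/

section Framework

set_option linter.unusedSimpArgs false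

attribute [local instance] zfStruct

/-- Elements of `M`. -/
abbrev XX (M : ZFSet) := {x : ZFSet // x ∈ M}

theorem r_reindex {M : ZFSet} {m k : ℕ} (f : Fin m → Fin k) (φ : BF m) (e : Empty → XX M)
    (v : Fin k → XX M) :
    (reindex f φ).Realize e v ↔ φ.Realize e (v ∘ f) := by
  unfold reindex
  refine (BoundedFormula.realize_relabel (m := k) (n := 0)).trans ?_
  rw [Subsingleton.elim (v ∘ Fin.natAdd k : Fin 0 → XX M) default]
  refine (BoundedFormula.realize_toFormula φ _).trans ?_
  have : ((Sum.elim e (v ∘ Fin.castAdd 0) ∘ Sum.map id f) ∘ Sum.inl : Empty → XX M) = e := by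
    funext x; exact x.elim
  rw [this]
  rfl

theorem r_mem {M : ZFSet} {n : ℕ} (i j : Fin n) (e : Empty → XX M) (v : Fin n → XX M) :
    (memf i j).Realize e v ↔ (v i).1 ∈ (v j).1 := by
  unfold memf
  rw [BoundedFormula.realize_rel₂]
  rfl

theorem r_eq {M : ZFSet} {n : ℕ} (i j : Fin n) (e : Empty → XX M) (v : Fin n → XX M) :
    (eqf i j).Realize e v ↔ v i = v j := by
  unfold eqf
  rw [BoundedFormula.realize_bdEqual]
  rfl

theorem r_and {M : ZFSet} {n : ℕ} (φ ψ : BF n) (e : Empty → XX M) (v : Fin n → XX M) :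
    (andF φ ψ).Realize e v ↔ φ.Realize e v ∧ ψ.Realize e v := by
  simp [andF]

theorem r_or {M : ZFSet} {n : ℕ} (φ ψ : BF n) (e : Empty → XX M) (v : Fin n → XX M) :
    (orF φ ψ).Realize e v ↔ φ.Realize e v ∨ ψ.Realize e v := by
  simp [orF]; tauto

theorem r_iff {M : ZFSet} {n : ℕ} (φ ψ : BF n) (e : Empty → XX M) (v : Fin n → XX M) :
    (iffF φ ψ).Realize e v ↔ (φ.Realize e v ↔ ψ.Realize e v) := by
  simp [iffF, r_and]; tauto

/-- Definable terms: variables and constants. -/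
def Tm {M : ZFSet} {n : ℕ} (t : (Fin n → XX M) → XX M) : Prop :=
  (∃ i, t = fun v => v i) ∨ ∃ c, t = fun _ => c

theorem Tm.var {M : ZFSet} {n : ℕ} (i : Fin n) : Tm (M := M) (fun v => v i) := Or.inl ⟨i, rfl⟩

theorem Tm.const {M : ZFSet} {n : ℕ} (c : XX M) : Tm (M := M) (n := n) (fun _ => c) :=
  Or.inr ⟨c, rfl⟩

/-- Definability with parameters over `M`. -/
def Dn {M : ZFSet} (n : ℕ) (R : (Fin n → XX M) → Prop) : Prop :=
  ∃ φ : SetLang.BoundedFormula (XX M) n, ∀ v, φ.Realize id v ↔ R v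

theorem Tm.lift {M : ZFSet} {n : ℕ} {t : (Fin n → XX M) → XX M} (h : Tm t) :
    Tm (n := n + 1) (fun w => t (fun i => w i.castSucc)) := by
  rcases h with ⟨i, rfl⟩ | ⟨c, rfl⟩
  · exact Tm.var _
  · exact Tm.const _

theorem Tm.ex {M : ZFSet} {n : ℕ} {t : (Fin n → XX M) → XX M} (h : Tm t) :
    ∃ s : SetLang.Term (XX M ⊕ Fin n), ∀ v, s.realize (Sum.elim id v) = t v := by
  rcases h with ⟨i, rfl⟩ | ⟨c, rfl⟩
  · exact ⟨Term.var (Sum.inr i), fun v => rfl⟩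
  · exact ⟨Term.var (Sum.inl c), fun v => rfl⟩

section
variable {M : ZFSet} {n : ℕ}

theorem Dn.congr {R S : (Fin n → XX M) → Prop} (h : Dn n R) (e : ∀ v, S v ↔ R v) : Dn n S := by
  obtain ⟨φ, h⟩ := h
  exact ⟨φ, fun v => (h v).trans (e v).symm⟩

theorem Dn.mem {s t : (Fin n → XX M) → XX M} (hs : Tm s) (ht : Tm t) :
    Dn n (fun v => (s v).1 ∈ (t v).1) := by
  obtain ⟨a, ha⟩ := hs.ex
  obtain ⟨b, hb⟩ := ht.ex
  refine ⟨memSymb.boundedFormula₂ a b, fun v => ?_⟩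
  rw [BoundedFormula.realize_rel₂, ha, hb]
  rfl

theorem Dn.eq {s t : (Fin n → XX M) → XX M} (hs : Tm s) (ht : Tm t) :
    Dn n (fun v => s v = t v) := by
  obtain ⟨a, ha⟩ := hs.ex
  obtain ⟨b, hb⟩ := ht.ex
  refine ⟨Term.bdEqual a b, fun v => ?_⟩
  rw [BoundedFormula.realize_bdEqual, ha, hb]

theorem Dn.false : Dn (M := M) n (fun _ => False) := ⟨⊥, fun _ => Iff.rfl⟩

theorem Dn.imp {R S : (Fin n → XX M) → Prop} (h : Dn n R) (h' : Dn n S) :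
    Dn n (fun v => R v → S v) := by
  obtain ⟨φ, h⟩ := h
  obtain ⟨ψ, h'⟩ := h'
  exact ⟨φ.imp ψ, fun v => by rw [BoundedFormula.realize_imp, h, h']⟩

theorem Dn.not {R : (Fin n → XX M) → Prop} (h : Dn n R) : Dn n (fun v => ¬ R v) :=
  h.imp Dn.false

theorem Dn.and {R S : (Fin n → XX M) → Prop} (h : Dn n R) (h' : Dn n S) :
    Dn n (fun v => R v ∧ S v) :=
  (h.imp h'.not).not.congr fun v => by tauto

theorem Dn.or {R S : (Fin n → XX M) → Prop} (h : Dn n R) (h' : Dn n S) :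
    Dn n (fun v => R v ∨ S v) :=
  (h.not.imp h').congr fun v => by tauto

theorem Dn.iff {R S : (Fin n → XX M) → Prop} (h : Dn n R) (h' : Dn n S) :
    Dn n (fun v => R v ↔ S v) :=
  ((h.imp h').and (h'.imp h)).congr fun v => by tauto

theorem Dn.all {R : (Fin n → XX M) → XX M → Prop}
    (h : Dn (n + 1) (fun w => R (fun i => w i.castSucc) (w (Fin.last n)))) :
    Dn n (fun v => ∀ x, R v x) := by
  obtain ⟨φ, h⟩ := h
  refine ⟨φ.all, fun v => ?_⟩
  rw [BoundedFormula.realize_all]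
  refine forall_congr' fun x => ?_
  rw [h]
  simp

theorem Dn.ex {R : (Fin n → XX M) → XX M → Prop}
    (h : Dn (n + 1) (fun w => R (fun i => w i.castSucc) (w (Fin.last n)))) :
    Dn n (fun v => ∃ x, R v x) :=
  (Dn.all (R := fun v x => ¬ R v x) h.not).not.congr fun v => by simp

/-- Convert a formula with constants to a formula with parameters in front. -/
theorem Dn.params {R : (Fin n → XX M) → Prop} (h : Dn n R) :
    ∃ (m : ℕ) (ψ : BF (m + n)) (c : Fin m → XX M), ∀ (e : Empty → XX M) (w : Fin (m + n) → XX M),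
      (∀ i, w (Fin.castAdd n i) = c i) → (ψ.Realize e w ↔ R (fun i => w (Fin.natAdd m i))) := by
  classical
  obtain ⟨φ, h⟩ := h
  let s := φ.freeVarFinset
  let eqv := s.equivFin
  refine ⟨s.card, BoundedFormula.relabel (n := s.card) (fun i : Fin s.card => Sum.inr i)
    (φ.restrictFreeVar (fun x => eqv x)), fun i => (eqv.symm i).1, fun e w hw => ?_⟩
  rw [BoundedFormula.realize_relabel, ← h]
  refine BoundedFormula.realize_restrictFreeVar id ?_
  rintro ⟨a, ha⟩
  simp [hw]

/-- Separation in `M`. -/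
theorem sepM (hM : ZModels M ZF) {R : XX M → Prop} (h : Dn 1 (fun v => R (v 0))) (A : XX M) :
    ∃ B : XX M, ∀ x : XX M, x.1 ∈ B.1 ↔ x.1 ∈ A.1 ∧ R x := by
  obtain ⟨m, ψ, c, hψ⟩ := h.params
  have h1 := hM (sepAx ψ) (Or.inl (Or.inr ⟨⟨m, ψ⟩, rfl⟩))
  unfold sepAx Sentence.Realize at h1
  dsimp only at h1
  rw [BoundedFormula.realize_alls] at h1
  have h2 := h1 c A
  rw [BoundedFormula.realize_ex] at h2
  obtain ⟨B, hB⟩ := h2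
  refine ⟨B, fun x => ?_⟩
  have h3 := hB x
  rw [r_iff, r_and, r_mem, r_mem, r_reindex, hψ] at h3
  · simpa [Fin.snoc] using h3
  · intro i
    simp [Fin.snoc, show (i : ℕ) < m + 1 + 1 by omega, show (i : ℕ) < m + 1 by omega,
        show (i : ℕ) ≤ m + 1 + 1 by omega, show (i : ℕ) ≤ m + 1 by omega,
        show ¬ (m + 1 < (i : ℕ)) by omega]

/-- Replacement in `M`. -/
theorem replM (hM : ZModels M ZF) {R : XX M → XX M → Prop}
    (h : Dn 2 (fun v => R (v 0) (v 1))) (A : XX M)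
    (hf : ∀ x y z : XX M, x.1 ∈ A.1 → R x y → R x z → y = z) :
    ∃ B : XX M, ∀ y : XX M, y.1 ∈ B.1 ↔ ∃ x : XX M, x.1 ∈ A.1 ∧ R x y := by
  obtain ⟨m, ψ, c, hψ⟩ := h.params
  have h1 := hM (replAx ψ) (Or.inr ⟨⟨m, ψ⟩, rfl⟩)
  unfold replAx Sentence.Realize at h1
  dsimp only at h1
  rw [BoundedFormula.realize_alls] at h1
  have h2 := h1 c A
  rw [BoundedFormula.realize_imp] at h2
  have h3 := h2 ?_
  · rw [BoundedFormula.realize_ex] at h3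
    obtain ⟨B, hB⟩ := h3
    refine ⟨B, fun y => ?_⟩
    have h3 := hB y
    rw [r_iff, r_mem, BoundedFormula.realize_ex] at h3
    rw [show (Fin.snoc (Fin.snoc (Fin.snoc c A) B) y : Fin (m + 3) → XX M) ⟨m + 2, by omega⟩ = y from by
        (simp [Fin.snoc]),
      show (Fin.snoc (Fin.snoc (Fin.snoc c A) B) y : Fin (m + 3) → XX M) ⟨m + 1, by omega⟩ = B from by
        (simp [Fin.snoc]) ] at h3
    refine h3.trans (exists_congr fun x => ?_)
    rw [r_and, r_mem, r_reindex, hψ]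
    · simp [Fin.snoc, show m ≤ m + 1 + 1 by omega]
    · intro i
      simp [Fin.snoc, show (i : ℕ) ≤ m + 1 + 1 by omega, show (i : ℕ) ≤ m + 1 by omega]
  · intro x y z
    rw [BoundedFormula.realize_imp, r_and, r_and, r_mem, r_reindex, r_reindex, r_eq, hψ, hψ]
    · simpa [Fin.snoc, show m ≤ m + 1 + 1 by omega] using fun a b c => hf x y z a b c
    · intro i
      simp [Fin.snoc, show (i : ℕ) < m + 1 + 1 by omega, show (i : ℕ) < m + 1 by omega,
        show (i : ℕ) ≤ m + 1 + 1 by omega, show (i : ℕ) ≤ m + 1 by omega,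
        show ¬ (m + 1 < (i : ℕ)) by omega]
    · intro i
      simp [Fin.snoc, show (i : ℕ) < m + 1 + 1 by omega, show (i : ℕ) < m + 1 by omega,
        show (i : ℕ) ≤ m + 1 + 1 by omega, show (i : ℕ) ≤ m + 1 by omega,
        show ¬ (m + 1 < (i : ℕ)) by omega]

theorem pairM (hM : ZModels M ZF) (hT : M.IsTransitive) (x y : XX M) :
    ({x.1, y.1} : ZFSet) ∈ M := by
  have h1 := hM pairAx (by simp [ZF, Z, zfFin])
  obtain ⟨z, hz⟩ := BoundedFormula.realize_ex.1 (h1 x y)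
  have : ({x.1, y.1} : ZFSet) = z.1 := by
    ext w
    rw [ZFSet.mem_pair]
    constructor
    · rintro (rfl | rfl)
      · have := hz x
        rw [r_iff, r_or, r_mem, r_eq, r_eq] at this
        simpa [Fin.snoc] using this
      · have := hz y
        rw [r_iff, r_or, r_mem, r_eq, r_eq] at this
        simpa [Fin.snoc] using this
    · intro hw
      have := hz ⟨w, hT.mem_trans hw z.2⟩
      rw [r_iff, r_or, r_mem, r_eq, r_eq] at this
      simpa [Fin.snoc, hw, Subtype.ext_iff] using this
  rw [this]
  exact z.2

theorem unionM (hM : ZModels M ZF) (hT : M.IsTransitive) (x : XX M) :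
    (ZFSet.sUnion x.1 : ZFSet) ∈ M := by
  have h1 := hM unionAx (by simp [ZF, Z, zfFin])
  obtain ⟨z, hz⟩ := BoundedFormula.realize_ex.1 (h1 x)
  have hz' : ∀ w : XX M, w.1 ∈ z.1 ↔ ∃ u : XX M, u.1 ∈ x.1 ∧ w.1 ∈ u.1 := fun w => by
    have := hz w
    rw [r_iff, r_mem, BoundedFormula.realize_ex] at this
    simp only [r_and, r_mem] at this
    simpa [Fin.snoc] using this
  have : (ZFSet.sUnion x.1 : ZFSet) = z.1 := by
    ext w
    rw [ZFSet.mem_sUnion]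
    constructor
    · rintro ⟨u, hu, hw⟩
      have hu' := hT.mem_trans hu x.2
      exact (hz' ⟨w, hT.mem_trans hw hu'⟩).2 ⟨⟨u, hu'⟩, hu, hw⟩
    · intro hw
      obtain ⟨u, hu, hw⟩ := (hz' ⟨w, hT.mem_trans hw z.2⟩).1 hw
      exact ⟨u.1, hu, hw⟩
  rw [this]
  exact z.2

theorem powM (hM : ZModels M ZF) (x : XX M) :
    ∃ y : XX M, ∀ z : XX M, z.1 ⊆ x.1 → z.1 ∈ y.1 := by
  have h1 := hM powAx (by simp [ZF, Z, zfFin])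
  obtain ⟨y, hy⟩ := BoundedFormula.realize_ex.1 (h1 x)
  refine ⟨y, fun z hz => ?_⟩
  have := hy z
  rw [r_iff, r_mem, r_reindex] at this
  have h2 := this.2 (fun w => by
    rw [BoundedFormula.realize_imp, r_mem, r_mem]
    exact fun hw => hz hw)
  exact h2

theorem prM (hM : ZModels M ZF) (hT : M.IsTransitive) (x y : XX M) : ZFSet.pair x.1 y.1 ∈ M := by
  have h1 := pairM hM hT x x
  have h2 := pairM hM hT x y
  have := pairM hM hT ⟨_, h1⟩ ⟨_, h2⟩
  simpa [ZFSet.pair] using this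

/-- A set in `M` containing all pairs from `x`. -/
theorem prodM (hM : ZModels M ZF) (hT : M.IsTransitive) (x : XX M) :
    ∃ y : XX M, ∀ a ∈ x.1, ∀ b ∈ x.1, ZFSet.pair a b ∈ y.1 := by
  obtain ⟨y, hy⟩ := powM hM x
  obtain ⟨z, hz⟩ := powM hM y
  refine ⟨z, fun a ha b hb => ?_⟩
  have ha' := hT.mem_trans ha x.2
  have hb' := hT.mem_trans hb x.2
  refine hz ⟨_, prM hM hT ⟨a, ha'⟩ ⟨b, hb'⟩⟩ fun w hw => ?_
  simp only [ZFSet.pair, ZFSet.mem_pair] at hw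
  rcases hw with rfl | rfl
  · have := pairM hM hT ⟨a, ha'⟩ ⟨a, ha'⟩
    refine hy ⟨_, by simpa using this⟩ fun u hu => ?_
    rw [ZFSet.mem_singleton] at hu
    exact hu ▸ ha
  · refine hy ⟨_, pairM hM hT ⟨a, ha'⟩ ⟨b, hb'⟩⟩ fun u hu => ?_
    rw [ZFSet.mem_pair] at hu
    rcases hu with rfl | rfl <;> assumption

theorem mem_of_pair {B a b : ZFSet} (hB : B.IsTransitive) (h : ZFSet.pair a b ∈ B) :
    a ∈ B ∧ b ∈ B := by
  have h1 : ({a, b} : ZFSet) ∈ B := hB.mem_trans (by simp [ZFSet.pair]) h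
  exact ⟨hB.mem_trans (by simp) h1, hB.mem_trans (by simp) h1⟩

/-! Basic definable relations -/

theorem Dn.sub {s t : (Fin n → XX M) → XX M} (hT : M.IsTransitive) (hs : Tm s) (ht : Tm t) :
    Dn n (fun v => (s v).1 ⊆ (t v).1) := by
  refine (Dn.all (R := fun v x => x.1 ∈ (s v).1 → x.1 ∈ (t v).1) ?_).congr fun v => ?_
  · exact (Dn.mem (Tm.var _) hs.lift).imp (Dn.mem (Tm.var _) ht.lift)
  · exact ⟨fun h x hx => h hx, fun h x hx => h ⟨x, hT.mem_trans hx (s v).2⟩ hx⟩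

theorem Dn.trans {s : (Fin n → XX M) → XX M} (hT : M.IsTransitive) (hs : Tm s) :
    Dn n (fun v => (s v).1.IsTransitive) := by
  refine (Dn.all (R := fun v x => x.1 ∈ (s v).1 → x.1 ⊆ (s v).1) ?_).congr fun v => ?_
  · exact (Dn.mem (Tm.var _) hs.lift).imp (Dn.sub hT (Tm.var _) hs.lift)
  · exact ⟨fun h x hx => h _ hx, fun h x hx => h ⟨x, hT.mem_trans hx (s v).2⟩ hx⟩

theorem Dn.pairSet {s t u : (Fin n → XX M) → XX M} (hT : M.IsTransitive)
    (hs : Tm s) (ht : Tm t) (hu : Tm u) :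
    Dn n (fun v => (s v).1 = {(t v).1, (u v).1}) := by
  refine (Dn.all (R := fun v x => x.1 ∈ (s v).1 ↔ (x = t v ∨ x = u v)) ?_).congr fun v => ?_
  · exact (Dn.mem (Tm.var _) hs.lift).iff ((Dn.eq (Tm.var _) ht.lift).or (Dn.eq (Tm.var _) hu.lift))
  · constructor
    · intro h x
      rw [h, ZFSet.mem_pair, Subtype.ext_iff, Subtype.ext_iff]
    · intro h
      ext x
      rw [ZFSet.mem_pair]
      constructor
      · intro hx
        have := (h ⟨x, hT.mem_trans hx (s v).2⟩).1 hx
        simpa [Subtype.ext_iff] using this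
      · rintro (rfl | rfl)
        · exact (h _).2 (Or.inl rfl)
        · exact (h _).2 (Or.inr rfl)

theorem Dn.isPair {s t u : (Fin n → XX M) → XX M} (hM : ZModels M ZF) (hT : M.IsTransitive)
    (hs : Tm s) (ht : Tm t) (hu : Tm u) :
    Dn n (fun v => (s v).1 = ZFSet.pair (t v).1 (u v).1) := by
  refine (Dn.ex (R := fun v x => ∃ y : XX M, x.1 = {(t v).1, (t v).1} ∧ y.1 = {(t v).1, (u v).1} ∧
    (s v).1 = {x.1, y.1}) ?_).congr fun v => ?_
  · refine Dn.ex ?_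
    exact (Dn.pairSet hT (Tm.var _) ht.lift.lift ht.lift.lift).and
      ((Dn.pairSet hT (Tm.var _) ht.lift.lift hu.lift.lift).and
      (Dn.pairSet hT hs.lift.lift (Tm.var _) (Tm.var _)))
  · constructor
    · intro h
      refine ⟨⟨_, pairM hM hT (t v) (t v)⟩, ⟨_, pairM hM hT (t v) (u v)⟩, rfl, rfl, ?_⟩
      simpa [ZFSet.pair] using h
    · rintro ⟨x, y, hx, hy, h⟩
      rw [h, hx, hy]
      simp [ZFSet.pair]

theorem Dn.prMem {s t u : (Fin n → XX M) → XX M} (hM : ZModels M ZF) (hT : M.IsTransitive)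
    (hs : Tm s) (ht : Tm t) (hu : Tm u) :
    Dn n (fun v => ZFSet.pair (s v).1 (t v).1 ∈ (u v).1) := by
  refine (Dn.ex (R := fun v x => x.1 = ZFSet.pair (s v).1 (t v).1 ∧ x.1 ∈ (u v).1) ?_).congr
    fun v => ?_
  · exact (Dn.isPair hM hT (Tm.var _) hs.lift ht.lift).and (Dn.mem (Tm.var _) hu.lift)
  · exact ⟨fun h => ⟨⟨_, prM hM hT _ _⟩, rfl, h⟩, fun ⟨x, hx, h⟩ => hx ▸ h⟩

theorem Dn.trMem {s t u w : (Fin n → XX M) → XX M} (hM : ZModels M ZF) (hT : M.IsTransitive)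
    (hs : Tm s) (ht : Tm t) (hu : Tm u) (hw : Tm w) :
    Dn n (fun v => ZFSet.pair (s v).1 (ZFSet.pair (t v).1 (u v).1) ∈ (w v).1) := by
  refine (Dn.ex (R := fun v x => x.1 = ZFSet.pair (t v).1 (u v).1 ∧
    ZFSet.pair (s v).1 x.1 ∈ (w v).1) ?_).congr fun v => ?_
  · exact (Dn.isPair hM hT (Tm.var _) ht.lift hu.lift).and
      (Dn.prMem hM hT hs.lift (Tm.var _) hw.lift)
  · exact ⟨fun h => ⟨⟨_, prM hM hT _ _⟩, rfl, h⟩, fun ⟨x, hx, h⟩ => hx ▸ h⟩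

/-- Least transitive superset, as seen in `M`. -/
def IsTC (x z : XX M) : Prop :=
  z.1.IsTransitive ∧ x.1 ⊆ z.1 ∧ ∀ w : XX M, w.1.IsTransitive → x.1 ⊆ w.1 → z.1 ⊆ w.1

theorem Dn.isTC {s t : (Fin n → XX M) → XX M} (hT : M.IsTransitive) (hs : Tm s) (ht : Tm t) :
    Dn n (fun v => IsTC (s v) (t v)) := by
  refine (Dn.trans hT ht).and ((Dn.sub hT hs ht).and ?_)
  exact Dn.all ((Dn.trans hT (Tm.var _)).imp ((Dn.sub hT hs.lift (Tm.var _)).imp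
    (Dn.sub hT ht.lift (Tm.var _))))

theorem exists_TC (hM : ZModels M ZF) (hT : M.IsTransitive) (x : ZFSet) (hx : x ∈ M) :
    ∃ z : XX M, IsTC ⟨x, hx⟩ z := by
  induction x using ZFSet.inductionOn with
  | _ x ih =>
  obtain ⟨B, hB⟩ := replM hM (R := IsTC) (Dn.isTC hT (Tm.var _) (Tm.var _)) ⟨x, hx⟩
    (fun a b c _ hb hc => Subtype.ext (LE.le.antisymm
      (hb.2.2 c hc.1 hc.2.1) (hc.2.2 b hb.1 hb.2.1)))
  have hz : x ∪ ZFSet.sUnion B.1 ∈ M :=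
    unionM hM hT ⟨_, pairM hM hT ⟨x, hx⟩ ⟨_, unionM hM hT B⟩⟩
  have key : ∀ b ∈ B.1, ∃ (b' : b ∈ M) (a : XX M), a.1 ∈ x ∧ IsTC a ⟨b, b'⟩ := fun b hb => by
    have b' := hT.mem_trans hb B.2
    obtain ⟨a, ha, h⟩ := (hB ⟨b, b'⟩).1 hb
    exact ⟨b', a, ha, h⟩
  refine ⟨⟨_, hz⟩, ?_, ?_, ?_⟩
  · intro y hy u hu
    rw [ZFSet.mem_union, ZFSet.mem_sUnion] at *
    right
    rcases hy with hy | ⟨b, hb, hy⟩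
    · obtain ⟨c, hc⟩ := ih y hy (hT.mem_trans hy hx)
      exact ⟨c.1, (hB c).2 ⟨_, hy, hc⟩, hc.2.1 hu⟩
    · obtain ⟨b', a, ha, h⟩ := key b hb
      exact ⟨b, hb, h.1.mem_trans hu hy⟩
  · intro u hu
    exact ZFSet.mem_union.2 (Or.inl hu)
  · intro w hw hxw u hu
    rcases ZFSet.mem_union.1 hu with hu | hu
    · exact hxw hu
    · obtain ⟨b, hb, hy⟩ := ZFSet.mem_sUnion.1 hu
      obtain ⟨b', a, ha, h⟩ := key b hb
      exact h.2.2 w hw (hw _ (hxw ha)) hy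

theorem exists_trans (hM : ZModels M ZF) (hT : M.IsTransitive) (x : XX M) :
    ∃ z : XX M, z.1.IsTransitive ∧ x.1 ∈ z.1 := by
  have h := pairM hM hT x x
  obtain ⟨z, hz⟩ := exists_TC hM hT _ h
  exact ⟨z, hz.1, hz.2.1 (by simp)⟩

end

end Framework

/-! ### Forcing -/

section Forcing

variable {M : ZFSet}

/-- Order of the forcing notion. -/
def le (r q p : XX M) : Prop := ZFSet.pair q.1 p.1 ∈ r.1

/-- `⟨a, b⟩ ∈ c`. -/
def pm (a b c : XX M) : Prop := ZFSet.pair a.1 b.1 ∈ c.1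

/-- `⟨a, b, c⟩ ∈ d`. -/
def tm (d a b c : XX M) : Prop := ZFSet.pair a.1 (ZFSet.pair b.1 c.1) ∈ d.1

/-- The forcing setting. -/
structure FC (P r : XX M) : Prop where
  hM : ZModels M ZF
  hT : M.IsTransitive
  leP : ∀ {q p : XX M}, le r q p → q.1 ∈ P.1 ∧ p.1 ∈ P.1
  refl : ∀ {p : XX M}, p.1 ∈ P.1 → le r p p
  tr : ∀ {p q s : XX M}, le r p q → le r q s → le r p s

/-- One step of the definition of forcing equality. -/
def Phi (r : XX M) (R : XX M → XX M → XX M → Prop) (p τ σ : XX M) : Prop :=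
  (∀ π s q : XX M, pm π s τ → le r q p → le r q s →
    ∃ t ρ u : XX M, le r t q ∧ pm ρ u σ ∧ le r t u ∧ R t π ρ) ∧
  (∀ ρ u q : XX M, pm ρ u σ → le r q p → le r q u →
    ∃ t π s : XX M, le r t q ∧ pm π s τ ∧ le r t s ∧ R t π ρ)

/-- Forcing equality. -/
def Eqv (r : XX M) (p τ σ : XX M) : Prop :=
  ∃ R : XX M, (∀ p τ σ : XX M, tm R p τ σ → Phi r (tm R) p τ σ) ∧ tm R p τ σ

theorem Phi.mono {r : XX M} {R S : XX M → XX M → XX M → Prop} (h : ∀ a b c, R a b c → S a b c)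
    {p τ σ : XX M} (hp : Phi r R p τ σ) : Phi r S p τ σ := by
  refine ⟨fun π s q a b c => ?_, fun π s q a b c => ?_⟩
  · obtain ⟨t, ρ, u, h1, h2, h3, h4⟩ := hp.1 π s q a b c
    exact ⟨t, ρ, u, h1, h2, h3, h _ _ _ h4⟩
  · obtain ⟨t, ρ, u, h1, h2, h3, h4⟩ := hp.2 π s q a b c
    exact ⟨t, ρ, u, h1, h2, h3, h _ _ _ h4⟩

theorem Eqv.phi {r p τ σ : XX M} (h : Eqv r p τ σ) : Phi r (Eqv r) p τ σ := by
  obtain ⟨R, h1, h2⟩ := h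
  exact (h1 _ _ _ h2).mono fun a b c h => ⟨R, h1, h⟩

section
variable {P r : XX M} {n : ℕ}

theorem Dn.le (C : FC P r) {s t : (Fin n → XX M) → XX M} (hs : Tm s) (ht : Tm t) :
    Dn n (fun v => le r (s v) (t v)) := Dn.prMem C.hM C.hT hs ht (Tm.const r)

theorem Dn.pm (C : FC P r) {s t u : (Fin n → XX M) → XX M} (hs : Tm s) (ht : Tm t) (hu : Tm u) :
    Dn n (fun v => pm (s v) (t v) (u v)) := Dn.prMem C.hM C.hT hs ht hu

theorem Dn.tm (C : FC P r) {s t u w : (Fin n → XX M) → XX M} (hs : Tm s) (ht : Tm t) (hu : Tm u)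
    (hw : Tm w) :
    Dn n (fun v => tm (s v) (t v) (u v) (w v)) := Dn.trMem C.hM C.hT ht hu hw hs

theorem Dn.phi (C : FC P r) {R : (Fin n → XX M) → XX M → XX M → XX M → Prop}
    {p τ σ : (Fin n → XX M) → XX M} (hp : Tm p) (hτ : Tm τ) (hσ : Tm σ)
    (hR : ∀ (m : ℕ) (f : Fin n → Fin m) (a b c : (Fin m → XX M) → XX M), Tm a → Tm b → Tm c →
      Dn m (fun v => R (fun i => v (f i)) (a v) (b v) (c v))) :
    Dn n (fun v => Phi r (R v) (p v) (τ v) (σ v)) := by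
  have key : ∀ (τ σ : (Fin n → XX M) → XX M), Tm τ → Tm σ →
      ∀ S : (Fin n → XX M) → XX M → XX M → XX M → Prop,
      (∀ (m : ℕ) (f : Fin n → Fin m) (a b c : (Fin m → XX M) → XX M), Tm a → Tm b → Tm c →
      Dn m (fun v => S (fun i => v (f i)) (a v) (b v) (c v))) →
      Dn n (fun v => ∀ π s q : XX M, CtmForcing.pm π s (τ v) → CtmForcing.le r q (p v) →
        CtmForcing.le r q s →
        ∃ t ρ u : XX M, CtmForcing.le r t q ∧ CtmForcing.pm ρ u (σ v) ∧ CtmForcing.le r t u ∧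
          S v t π ρ) := by
    intro τ σ hτ hσ S hS
    refine Dn.all (Dn.all (Dn.all ?_))
    refine (Dn.pm C (Tm.var _) (Tm.var _) hτ.lift.lift.lift).imp
      ((Dn.le C (Tm.var _) hp.lift.lift.lift).imp ((Dn.le C (Tm.var _) (Tm.var _)).imp ?_))
    refine Dn.ex (Dn.ex (Dn.ex ?_))
    refine (Dn.le C (Tm.var _) (Tm.var _)).and
      ((Dn.pm C (Tm.var _) (Tm.var _) hσ.lift.lift.lift.lift.lift.lift).and
      ((Dn.le C (Tm.var _) (Tm.var _)).and ?_))
    exact hS _ (fun i => i.castSucc.castSucc.castSucc.castSucc.castSucc.castSucc) _ _ _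
      (Tm.var _) (Tm.var _) (Tm.var _)
  exact (key τ σ hτ hσ R hR).and (key σ τ hσ hτ (fun v a b c => R v a c b)
    fun m f a b c ha hb hc => hR m f a c b ha hc hb)

theorem Dn.eqv (C : FC P r) {p τ σ : (Fin n → XX M) → XX M} (hp : Tm p) (hτ : Tm τ) (hσ : Tm σ) :
    Dn n (fun v => Eqv r (p v) (τ v) (σ v)) := by
  refine Dn.ex ((Dn.all (Dn.all (Dn.all ?_))).and (Dn.tm C (Tm.var _) hp.lift hτ.lift hσ.lift))
  refine (Dn.tm C (Tm.var _) (Tm.var _) (Tm.var _) (Tm.var _)).imp ?_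
  refine Dn.phi C (Tm.var _) (Tm.var _) (Tm.var _) ?_
  intro m f a b c ha hb hc
  exact Dn.tm C (Tm.var _) ha hb hc

theorem Eqv.of_phi (C : FC P r) {p τ σ : XX M} (h : Phi r (Eqv r) p τ σ) : Eqv r p τ σ := by
  let w : XX M := ⟨_, prM C.hM C.hT τ σ⟩
  let w1 : XX M := ⟨_, prM C.hM C.hT P w⟩
  let w2 : XX M := ⟨_, prM C.hM C.hT p w1⟩
  obtain ⟨B, hB, hw2⟩ := exists_trans C.hM C.hT w2
  obtain ⟨hp, hw1⟩ := mem_of_pair hB hw2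
  obtain ⟨hP, hw⟩ := mem_of_pair hB hw1
  obtain ⟨hτ, hσ⟩ := mem_of_pair hB hw
  obtain ⟨S, hS⟩ := prodM C.hM C.hT B
  let U : XX M := ⟨B.1 ∪ S.1, unionM C.hM C.hT ⟨_, pairM C.hM C.hT B S⟩⟩
  obtain ⟨S', hS'⟩ := prodM C.hM C.hT U
  have hS3 : ∀ a ∈ B.1, ∀ b ∈ B.1, ∀ c ∈ B.1, ZFSet.pair a (ZFSet.pair b c) ∈ S'.1 :=
    fun a ha b hb c hc => hS' _ (ZFSet.mem_union.2 (Or.inl ha)) _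
      (ZFSet.mem_union.2 (Or.inr (hS b hb c hc)))
  obtain ⟨R, hR⟩ := sepM C.hM (R := fun z => ∃ a b c x : XX M, x.1 = ZFSet.pair b.1 c.1 ∧
    z.1 = ZFSet.pair a.1 x.1 ∧ a.1 ∈ B.1 ∧ b.1 ∈ B.1 ∧ c.1 ∈ B.1 ∧ Phi r (Eqv r) a b c) (by
      refine Dn.ex (Dn.ex (Dn.ex (Dn.ex ?_)))
      refine (Dn.isPair C.hM C.hT (Tm.var _) (Tm.var _) (Tm.var _)).and
        ((Dn.isPair C.hM C.hT (Tm.var _) (Tm.var _) (Tm.var _)).and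
        ((Dn.mem (Tm.var _) (Tm.const _)).and ((Dn.mem (Tm.var _) (Tm.const _)).and
        ((Dn.mem (Tm.var _) (Tm.const _)).and ?_))))
      exact Dn.phi C (Tm.var _) (Tm.var _) (Tm.var _) fun m f a b c ha hb hc =>
        Dn.eqv C ha hb hc) S'
  have hR' : ∀ a b c : XX M, tm R a b c ↔
      a.1 ∈ B.1 ∧ b.1 ∈ B.1 ∧ c.1 ∈ B.1 ∧ Phi r (Eqv r) a b c := by
    intro a b c
    constructor
    · intro h
      obtain ⟨_, a', b', c', x, hx, he, h1, h2, h3, h4⟩ :=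
        (hR ⟨_, C.hT.mem_trans h R.2⟩).1 h
      rw [hx] at he
      obtain ⟨e1, e2⟩ := ZFSet.pair_inj.1 he
      obtain ⟨e2, e3⟩ := ZFSet.pair_inj.1 e2
      obtain rfl := Subtype.ext e1
      obtain rfl := Subtype.ext e2
      obtain rfl := Subtype.ext e3
      exact ⟨h1, h2, h3, h4⟩
    · rintro ⟨h1, h2, h3, h4⟩
      have h5 := hS3 _ h1 _ h2 _ h3
      exact (hR ⟨_, C.hT.mem_trans h5 S'.2⟩).2
        ⟨h5, a, b, c, ⟨_, prM C.hM C.hT b c⟩, rfl, rfl, h1, h2, h3, h4⟩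
  refine ⟨R, ?_, (hR' _ _ _).2 ⟨hp, hτ, hσ, h⟩⟩
  intro a b c habc
  obtain ⟨h1, h2, h3, h4⟩ := (hR' _ _ _).1 habc
  refine ⟨fun π s q x y z => ?_, fun π s q x y z => ?_⟩
  · obtain ⟨t, ρ, u, h5, h6, h7, h8⟩ := h4.1 π s q x y z
    refine ⟨t, ρ, u, h5, h6, h7, (hR' _ _ _).2 ⟨?_, ?_, ?_, h8.phi⟩⟩
    · exact hB.mem_trans (C.leP h5).1 hP
    · exact (mem_of_pair hB (hB.mem_trans x h2)).1
    · exact (mem_of_pair hB (hB.mem_trans h6 h3)).1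
  · obtain ⟨t, ρ, u, h5, h6, h7, h8⟩ := h4.2 π s q x y z
    refine ⟨t, ρ, u, h5, h6, h7, (hR' _ _ _).2 ⟨?_, ?_, ?_, h8.phi⟩⟩
    · exact hB.mem_trans (C.leP h5).1 hP
    · exact (mem_of_pair hB (hB.mem_trans h6 h2)).1
    · exact (mem_of_pair hB (hB.mem_trans x h3)).1

theorem Eqv.mono (C : FC P r) {p q τ σ : XX M} (h : Eqv r p τ σ) (hq : le r q p) :
    Eqv r q τ σ := by
  refine Eqv.of_phi C ⟨fun π s t a b c => ?_, fun π s t a b c => ?_⟩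
  · exact h.phi.1 π s t a (C.tr b hq) c
  · exact h.phi.2 π s t a (C.tr b hq) c

/-! Values -/

theorem mem_zval {G τ y : ZFSet} :
    y ∈ zval G τ ↔ ∃ σ p, p ∈ G ∧ ZFSet.pair σ p ∈ τ ∧ zval G σ = y := by
  have hr : ∀ σ p : ZFSet, ZFSet.pair σ p ∈ τ →
      σ ∈ ZFSet.sUnion (ZFSet.sUnion τ) ∧ ZFSet.rank σ < ZFSet.rank τ := by
    intro σ p h
    have h1 : σ ∈ ({σ} : ZFSet) := by simp
    have h2 : ({σ} : ZFSet) ∈ ZFSet.pair σ p := by simp [ZFSet.pair]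
    refine ⟨ZFSet.mem_sUnion.2 ⟨_, ZFSet.mem_sUnion.2 ⟨_, h, h2⟩, h1⟩, ?_⟩
    exact (ZFSet.rank_lt_of_mem h1).trans ((ZFSet.rank_lt_of_mem h2).trans (ZFSet.rank_lt_of_mem h))
  unfold zval
  rw [WellFounded.fix_eq]
  rw [@ZFSet.mem_image _ (_)]
  simp only [ZFSet.mem_sep]
  constructor
  · rintro ⟨σ, ⟨_, p, hp, h⟩, rfl⟩
    refine ⟨σ, p, hp, h, ?_⟩
    rw [dif_pos (hr _ _ h).2]
  · rintro ⟨σ, p, hp, h, rfl⟩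
    refine ⟨σ, ⟨(hr _ _ h).1, p, hp, h⟩, ?_⟩
    rw [dif_pos (hr _ _ h).2]

theorem mem_genExt {G y : ZFSet} : y ∈ genExt M G ↔ ∃ τ ∈ M, zval G τ = y := by
  unfold genExt
  rw [@ZFSet.mem_image _ (_)]

/-- Generic filters, relative to the setting. -/
structure GC (P r : XX M) (G : ZFSet) : Prop where
  sub : ∀ {p : ZFSet}, p ∈ G → p ∈ P.1
  up : ∀ {p q : XX M}, p.1 ∈ G → le r p q → q.1 ∈ G
  dir : ∀ {p q : XX M}, p.1 ∈ G → q.1 ∈ G → ∃ t : XX M, t.1 ∈ G ∧ le r t p ∧ le r t q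
  gen : ∀ S : XX M → Prop, Dn 1 (fun v => S (v 0)) →
    (∀ p : XX M, p.1 ∈ P.1 → ∃ d, le r d p ∧ S d) → ∃ q : XX M, q.1 ∈ G ∧ S q

theorem GC.below {G : ZFSet} (C : FC P r) (g : GC P r G) {p : XX M} (hp : p.1 ∈ G)
    {S : XX M → Prop} (hS : Dn 1 (fun v => S (v 0)))
    (h : ∀ q, le r q p → ∃ t, le r t q ∧ S t) : ∃ q : XX M, q.1 ∈ G ∧ S q := by
  obtain ⟨q, hq, h1 | h1⟩ := g.gen (fun d => S d ∨ ∀ e, le r e d → ¬ le r e p)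
    (hS.or (Dn.all ((Dn.le C (Tm.var _) (Tm.var _)).imp
      (Dn.le C (Tm.var _) (Tm.const _)).not))) (by
      intro a ha
      by_cases hc : ∃ e, le r e a ∧ le r e p
      · obtain ⟨e, h1, h2⟩ := hc
        obtain ⟨t, h3, h4⟩ := h e h2
        exact ⟨t, C.tr h3 h1, Or.inl h4⟩
      · exact ⟨a, C.refl ha, Or.inr fun e h1 h2 => hc ⟨e, h1, h2⟩⟩)
  · exact ⟨q, hq, h1⟩
  · obtain ⟨t, _, h2, h3⟩ := g.dir hq hp
    exact (h1 t h2 h3).elim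

theorem pm_up {G : ZFSet} {π s τ : XX M} (h : pm π s τ) (hs : s.1 ∈ G) :
    zval G π.1 ∈ zval G τ.1 := mem_zval.2 ⟨_, _, hs, h, rfl⟩

theorem pm_down {G : ZFSet} (C : FC P r) {τ : XX M} {y : ZFSet} (h : y ∈ zval G τ.1) :
    ∃ π s : XX M, s.1 ∈ G ∧ pm π s τ ∧ zval G π.1 = y := by
  obtain ⟨σ, p, hp, h0, rfl⟩ := mem_zval.1 h
  obtain ⟨h1, h2⟩ := mem_of_pair C.hT (C.hT.mem_trans h0 τ.2)
  exact ⟨⟨σ, h1⟩, ⟨p, h2⟩, hp, h0, rfl⟩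

theorem pm_rank {π s τ : XX M} (h : pm π s τ) : ZFSet.rank π.1 < ZFSet.rank τ.1 := by
  have h1 : π.1 ∈ ({π.1} : ZFSet) := by simp
  have h2 : ({π.1} : ZFSet) ∈ ZFSet.pair π.1 s.1 := by simp [ZFSet.pair]
  exact (ZFSet.rank_lt_of_mem h1).trans ((ZFSet.rank_lt_of_mem h2).trans (ZFSet.rank_lt_of_mem h))

theorem eqv_truth {G : ZFSet} (C : FC P r) (g : GC P r G) (τ σ : XX M) :
    zval G τ.1 = zval G σ.1 ↔ ∃ p : XX M, p.1 ∈ G ∧ Eqv r p τ σ := by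
  induction h : ZFSet.rank τ.1 using WellFoundedLT.induction generalizing τ σ with
  | _ o ih =>
  subst h
  have ih : ∀ π s ρ : XX M, pm π s τ →
    (zval G π.1 = zval G ρ.1 ↔ ∃ p : XX M, p.1 ∈ G ∧ Eqv r p π ρ) :=
    fun π s ρ h => ih _ (pm_rank h) π ρ rfl
  constructor
  · intro heq
    obtain ⟨p, hp, h1 | h1 | h1⟩ := g.gen (fun p => Eqv r p τ σ ∨
      (∃ π s, pm π s τ ∧ le r p s ∧ ∀ t ρ u, le r t p → pm ρ u σ → le r t u → ¬ Eqv r t π ρ) ∨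
      (∃ ρ u, pm ρ u σ ∧ le r p u ∧ ∀ t π s, le r t p → pm π s τ → le r t s → ¬ Eqv r t π ρ))
      (by
        refine (Dn.eqv C (Tm.var _) (Tm.const _) (Tm.const _)).or (Dn.or ?_ ?_)
        · refine Dn.ex (Dn.ex ((Dn.pm C (Tm.var _) (Tm.var _) (Tm.const _)).and
            ((Dn.le C (Tm.var _) (Tm.var _)).and (Dn.all (Dn.all (Dn.all ?_))))))
          exact (Dn.le C (Tm.var _) (Tm.var _)).imp ((Dn.pm C (Tm.var _) (Tm.var _)
            (Tm.const _)).imp ((Dn.le C (Tm.var _) (Tm.var _)).imp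
            (Dn.eqv C (Tm.var _) (Tm.var _) (Tm.var _)).not))
        · refine Dn.ex (Dn.ex ((Dn.pm C (Tm.var _) (Tm.var _) (Tm.const _)).and
            ((Dn.le C (Tm.var _) (Tm.var _)).and (Dn.all (Dn.all (Dn.all ?_))))))
          exact (Dn.le C (Tm.var _) (Tm.var _)).imp ((Dn.pm C (Tm.var _) (Tm.var _)
            (Tm.const _)).imp ((Dn.le C (Tm.var _) (Tm.var _)).imp
            (Dn.eqv C (Tm.var _) (Tm.var _) (Tm.var _)).not)))
      (by
        intro p hp
        by_cases hc : Phi r (Eqv r) p τ σ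
        · exact ⟨p, C.refl hp, Or.inl (Eqv.of_phi C hc)⟩
        · unfold Phi at hc
          rw [not_and_or] at hc
          push Not at hc
          rcases hc with ⟨π, s, q, h1, h2, h3, h4⟩ | ⟨π, s, q, h1, h2, h3, h4⟩
          · exact ⟨q, h2, Or.inr (Or.inl ⟨π, s, h1, h3, h4⟩)⟩
          · exact ⟨q, h2, Or.inr (Or.inr ⟨π, s, h1, h3, h4⟩)⟩)
    · exact ⟨p, hp, h1⟩
    · obtain ⟨π, s, h2, h3, h4⟩ := h1
      have h5 := pm_up h2 (g.up hp h3)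
      rw [heq] at h5
      obtain ⟨ρ, u, hu, h6, h7⟩ := pm_down C h5
      obtain ⟨t, ht, h8⟩ := (ih π s ρ h2).1 h7.symm
      obtain ⟨a, ha, h9, h10⟩ := g.dir ht hu
      obtain ⟨b, hb, h11, h12⟩ := g.dir ha hp
      exact (h4 b ρ u h12 h6 (C.tr h11 h10) (h8.mono C (C.tr h11 h9))).elim
    · obtain ⟨ρ, u, h2, h3, h4⟩ := h1
      have h5 := pm_up h2 (g.up hp h3)
      rw [← heq] at h5
      obtain ⟨π, s, hs, h6, h7⟩ := pm_down C h5
      obtain ⟨t, ht, h8⟩ := (ih π s ρ h6).1 h7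
      obtain ⟨a, ha, h9, h10⟩ := g.dir ht hs
      obtain ⟨b, hb, h11, h12⟩ := g.dir ha hp
      exact (h4 b π s h12 h6 (C.tr h11 h10) (h8.mono C (C.tr h11 h9))).elim
  · rintro ⟨p, hp, h⟩
    ext y
    constructor
    · intro hy
      obtain ⟨π, s, hs, h1, rfl⟩ := pm_down C hy
      obtain ⟨q, hq, h2, h3⟩ := g.dir hp hs
      obtain ⟨t, ht, ρ, u, h4, h5, h6⟩ := g.below C hq
        (S := fun t => ∃ ρ u, pm ρ u σ ∧ le r t u ∧ Eqv r t π ρ)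
        (Dn.ex (Dn.ex ((Dn.pm C (Tm.var _) (Tm.var _) (Tm.const _)).and
          ((Dn.le C (Tm.var _) (Tm.var _)).and (Dn.eqv C (Tm.var _) (Tm.const _) (Tm.var _))))))
        (fun a ha => by
          obtain ⟨t, ρ, u, h4, h5⟩ := h.phi.1 π s a h1 (C.tr ha h2) (C.tr ha h3)
          exact ⟨t, h4, ρ, u, h5⟩)
      rw [(ih π s ρ h1).2 ⟨t, ht, h6⟩]
      exact pm_up h4 (g.up ht h5)
    · intro hy
      obtain ⟨ρ, u, hs, h1, rfl⟩ := pm_down C hy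
      obtain ⟨q, hq, h2, h3⟩ := g.dir hp hs
      obtain ⟨t, ht, π, s, h4, h5, h6⟩ := g.below C hq
        (S := fun t => ∃ π s, pm π s τ ∧ le r t s ∧ Eqv r t π ρ)
        (Dn.ex (Dn.ex ((Dn.pm C (Tm.var _) (Tm.var _) (Tm.const _)).and
          ((Dn.le C (Tm.var _) (Tm.var _)).and (Dn.eqv C (Tm.var _) (Tm.var _) (Tm.const _))))))
        (fun a ha => by
          obtain ⟨t, π, s, h4, h5⟩ := h.phi.2 ρ u a h1 (C.tr ha h2) (C.tr ha h3)
          exact ⟨t, h4, π, s, h5⟩)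
      rw [← (ih π s ρ h4).2 ⟨t, ht, h6⟩]
      exact pm_up h4 (g.up ht h5)

/-- Forcing membership. -/
def Mmv (r p τ σ : XX M) : Prop := ∃ ρ u, pm ρ u σ ∧ le r p u ∧ Eqv r p τ ρ

theorem Dn.mmv (C : FC P r) {p τ σ : (Fin n → XX M) → XX M} (hp : Tm p) (hτ : Tm τ) (hσ : Tm σ) :
    Dn n (fun v => Mmv r (p v) (τ v) (σ v)) :=
  Dn.ex (Dn.ex ((Dn.pm C (Tm.var _) (Tm.var _) hσ.lift.lift).and
    ((Dn.le C hp.lift.lift (Tm.var _)).and (Dn.eqv C hp.lift.lift hτ.lift.lift (Tm.var _)))))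

theorem Mmv.mono (C : FC P r) {p q τ σ : XX M} (h : Mmv r p τ σ) (hq : le r q p) :
    Mmv r q τ σ := by
  obtain ⟨ρ, u, h1, h2, h3⟩ := h
  exact ⟨ρ, u, h1, C.tr hq h2, h3.mono C hq⟩

theorem mmv_truth {G : ZFSet} (C : FC P r) (g : GC P r G) (τ σ : XX M) :
    zval G τ.1 ∈ zval G σ.1 ↔ ∃ p : XX M, p.1 ∈ G ∧ Mmv r p τ σ := by
  constructor
  · intro h
    obtain ⟨ρ, u, hu, h1, h2⟩ := pm_down C h
    obtain ⟨p, hp, h3⟩ := (eqv_truth C g τ ρ).1 h2.symm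
    obtain ⟨q, hq, h4, h5⟩ := g.dir hp hu
    exact ⟨q, hq, ρ, u, h1, h5, h3.mono C h4⟩
  · rintro ⟨p, hp, ρ, u, h1, h2, h3⟩
    rw [(eqv_truth C g τ ρ).2 ⟨p, hp, h3⟩]
    exact pm_up h1 (g.up hp h2)

/-- Value of an `L`-term (always a variable). -/
def tv {X : Type*} {k : ℕ} (t : SetLang.Term (Empty ⊕ Fin k)) (τ : Fin k → X) : X :=
  match t with
  | .var (.inr i) => τ i
  | .var (.inl e) => e.elim
  | .func f _ => Empty.elim f

/-- The forcing relation. -/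
def Fc (r : XX M) : {k : ℕ} → BF k → XX M → (Fin k → XX M) → Prop
  | _, .falsum, _, _ => False
  | _, .equal t s, p, τ => Eqv r p (tv t τ) (tv s τ)
  | _, .rel (l := l) R ts, p, τ =>
    match l, R, ts with
    | _, .mem, ts => Mmv r p (tv (ts 0) τ) (tv (ts 1) τ)
  | _, .imp φ ψ, p, τ => ∀ q, le r q p → Fc r φ q τ → ∃ t, le r t q ∧ Fc r ψ t τ
  | _, .all φ, p, τ => ∀ x q, le r q p → ∃ t, le r t q ∧ Fc r φ t (Fin.snoc (α := fun _ => XX M) τ x)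

theorem Tm.tv {k : ℕ} (t : SetLang.Term (Empty ⊕ Fin k)) {τ : (Fin n → XX M) → Fin k → XX M}
    (h : ∀ i, Tm (fun v => τ v i)) : Tm (fun v => tv t (τ v)) := by
  rcases t with (e | i) | ⟨f, _⟩
  · exact e.elim
  · exact h i
  · exact Empty.elim f

theorem Dn.fc (C : FC P r) {k : ℕ} (φ : BF k) : ∀ {n : ℕ} {p : (Fin n → XX M) → XX M}
    {τ : (Fin n → XX M) → Fin k → XX M}, Tm p → (∀ i, Tm (fun v => τ v i)) →
    Dn n (fun v => Fc r φ (p v) (τ v)) := by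
  induction φ with
  | falsum => intro n p τ hp hτ; exact Dn.false
  | equal t s => intro n p τ hp hτ; exact Dn.eqv C hp (Tm.tv t hτ) (Tm.tv s hτ)
  | rel R ts =>
    intro n p τ hp hτ
    cases R
    exact Dn.mmv C hp (Tm.tv _ hτ) (Tm.tv _ hτ)
  | imp φ ψ ih1 ih2 =>
    intro n p τ hp hτ
    exact Dn.all ((Dn.le C (Tm.var _) hp.lift).imp ((ih1 (Tm.var _) fun i => (hτ i).lift).imp
      (Dn.ex ((Dn.le C (Tm.var _) (Tm.var _)).and
        (ih2 (Tm.var _) fun i => (hτ i).lift.lift)))))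
  | all φ ih =>
    intro n p τ hp hτ
    refine Dn.all (Dn.all ((Dn.le C (Tm.var _) hp.lift.lift).imp
      (Dn.ex ((Dn.le C (Tm.var _) (Tm.var _)).and (ih (Tm.var _) fun i => ?_)))))
    refine Fin.lastCases ?_ (fun i => ?_) i
    · simp only [Fin.snoc_last]
      exact Tm.var _
    · simp only [Fin.snoc_castSucc]
      exact (hτ i).lift.lift.lift

theorem Fc.mono (C : FC P r) {k : ℕ} (φ : BF k) {p q : XX M} {τ : Fin k → XX M}
    (h : Fc r φ p τ) (hq : le r q p) : Fc r φ q τ := by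
  cases φ with
  | falsum => exact h
  | equal t s => exact Eqv.mono C h hq
  | rel R ts => cases R; exact Mmv.mono C h hq
  | imp φ ψ => exact fun a ha => h a (C.tr ha hq)
  | all φ => exact fun x a ha => h x a (C.tr ha hq)

attribute [local instance] zfStruct

theorem tv_realize {G : ZFSet} {k : ℕ} (t : SetLang.Term (Empty ⊕ Fin k)) (e : Empty → XX (genExt M G))
    (τ : Fin k → XX M) (v : Fin k → XX (genExt M G)) (h : ∀ i, (v i).1 = zval G (τ i).1) :
    (t.realize (Sum.elim e v)).1 = zval G (tv t τ).1 := by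
  rcases t with (e | i) | ⟨f, _⟩
  · exact e.elim
  · exact h i
  · exact Empty.elim f

theorem fc_truth {G : ZFSet} (C : FC P r) (g : GC P r G) {k : ℕ} (φ : BF k)
    (e : Empty → XX (genExt M G)) :
    ∀ (τ : Fin k → XX M) (v : Fin k → XX (genExt M G)), (∀ i, (v i).1 = zval G (τ i).1) →
    (φ.Realize e v ↔ ∃ p : XX M, p.1 ∈ G ∧ Fc r φ p τ) := by
  induction φ with
  | falsum =>
    intro τ v h
    exact ⟨fun h => h.elim, fun ⟨_, _, h⟩ => h⟩
  | equal t s =>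
    intro τ v h
    refine Iff.trans ?_ (eqv_truth C g (tv t τ) (tv s τ))
    rw [← tv_realize t e τ v h, ← tv_realize s e τ v h]
    exact Subtype.ext_iff
  | rel R ts =>
    intro τ v h
    cases R
    refine Iff.trans ?_ (mmv_truth C g (tv (ts 0) τ) (tv (ts 1) τ))
    rw [← tv_realize (ts 0) e τ v h, ← tv_realize (ts 1) e τ v h]
    exact Iff.rfl
  | imp φ ψ ih1 ih2 =>
    intro τ v h
    rw [BoundedFormula.realize_imp, ih1 τ v h, ih2 τ v h]
    constructor
    · intro hi
      obtain ⟨p, hp, h1 | ⟨h1, h2⟩⟩ := g.gen (fun p => Fc r (φ.imp ψ) p τ ∨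
        (Fc r φ p τ ∧ ∀ t, le r t p → ¬ Fc r ψ t τ))
        (by
          refine Dn.or ?_ (Dn.and ?_ (Dn.all (Dn.imp (Dn.le C (Tm.var _) (Tm.var _)) (Dn.not ?_))))
          · exact Dn.fc C (φ.imp ψ) (τ := fun _ => τ) (Tm.var _) fun i => Tm.const _
          · exact Dn.fc C φ (τ := fun _ => τ) (Tm.var _) fun i => Tm.const _
          · exact Dn.fc C ψ (τ := fun _ => τ) (Tm.var _) fun i => Tm.const _)
        (fun p hp => by
          by_cases hc : Fc r (φ.imp ψ) p τ
          · exact ⟨p, C.refl hp, Or.inl hc⟩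
          · unfold Fc at hc
            push Not at hc
            obtain ⟨q, h1, h2, h3⟩ := hc
            exact ⟨q, h1, Or.inr ⟨h2, h3⟩⟩)
      · exact ⟨p, hp, h1⟩
      · obtain ⟨q, hq, h3⟩ := hi ⟨p, hp, h1⟩
        obtain ⟨t, ht, h4, h5⟩ := g.dir hp hq
        exact (h2 t h4 (h3.mono C _ h5)).elim
    · rintro ⟨p, hp, h1⟩ ⟨q, hq, h2⟩
      obtain ⟨t, ht, h4, h5⟩ := g.dir hp hq
      exact g.below C ht (S := fun t => Fc r ψ t τ) (Dn.fc C _ (Tm.var _) fun i => Tm.const _)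
        fun a ha => h1 a (C.tr ha h4) (h2.mono C _ (C.tr ha h5))
  | all φ ih =>
    intro τ v h
    rw [BoundedFormula.realize_all]
    have hs : ∀ (x : XX M) (y : XX (genExt M G)), y.1 = zval G x.1 →
        ∀ i, ((Fin.snoc v y : Fin _ → XX (genExt M G)) i).1 =
          zval G ((Fin.snoc τ x : Fin _ → XX M) i).1 := by
      intro x y hxy i
      refine Fin.lastCases ?_ (fun i => ?_) i
      · simpa using hxy
      · simpa using h i
    constructor
    · intro hi
      obtain ⟨p, hp, h1 | ⟨x, h1⟩⟩ := g.gen (fun p => Fc r φ.all p τ ∨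
        ∃ x : XX M, ∀ t, le r t p → ¬ Fc r φ t (Fin.snoc τ x : Fin _ → XX M))
        (by
          refine Dn.or ?_ (Dn.ex (Dn.all (Dn.imp (Dn.le C (Tm.var _) (Tm.var _)) (Dn.not ?_))))
          · exact Dn.fc C φ.all (τ := fun _ => τ) (Tm.var _) fun i => Tm.const _
          · refine Dn.fc C φ (Tm.var _) fun i => ?_
            refine Fin.lastCases ?_ (fun i => ?_) i
            · simp only [Fin.snoc_last]
              exact Tm.var _
            · simp only [Fin.snoc_castSucc]
              exact Tm.const _)
        (fun p hp => by
          by_cases hc : Fc r φ.all p τ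
          · exact ⟨p, C.refl hp, Or.inl hc⟩
          · unfold Fc at hc
            push Not at hc
            obtain ⟨x, q, h1, h2⟩ := hc
            exact ⟨q, h1, Or.inr ⟨x, h2⟩⟩)
      · exact ⟨p, hp, h1⟩
      · obtain ⟨q, hq, h3⟩ := (ih _ _ (hs x ⟨_, mem_genExt.2 ⟨x.1, x.2, rfl⟩⟩ rfl)).1 (hi _)
        obtain ⟨t, ht, h4, h5⟩ := g.dir hp hq
        exact (h1 t h4 (h3.mono C _ h5)).elim
    · rintro ⟨p, hp, h1⟩ ⟨y, hy⟩
      obtain ⟨x, hx, rfl⟩ := mem_genExt.1 hy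
      refine (ih _ _ (hs ⟨x, hx⟩ ⟨_, hy⟩ rfl)).2 ?_
      exact g.below C hp (S := fun t => Fc r φ t (Fin.snoc τ (⟨x, hx⟩ : XX M) : Fin _ → XX M))
        (Dn.fc C _ (Tm.var _) fun i => Tm.const _) (h1 _)

end

theorem FC.mk' {P r one : ZFSet} (hM : ZModels M ZF) (hT : M.IsTransitive)
    (h : ForcingNotion M P r one) : FC (M := M) ⟨P, h.1⟩ ⟨r, h.2.1⟩ := by
  obtain ⟨h1, h2, h3, h4, h5, h6, h7⟩ := h
  have hl : ∀ {q p : XX M}, le ⟨r, h2⟩ q p → q.1 ∈ P ∧ p.1 ∈ P := by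
    intro q p hqp
    obtain ⟨a, ha, b, hb, e⟩ := h4 _ hqp
    obtain ⟨e1, e2⟩ := ZFSet.pair_inj.1 e
    exact ⟨e1 ▸ ha, e2 ▸ hb⟩
  refine ⟨hM, hT, hl, fun hp => h5 _ hp, fun a b => ?_⟩
  exact h6 _ (hl a).1 _ (hl a).2 _ (hl b).2 a b

theorem GC.mk' {P r : XX M} {G : ZFSet} (C : FC P r) (h : IsGeneric M r.1 P.1 G) :
    GC P r G := by
  obtain ⟨⟨h1, h2, h3⟩, h4⟩ := h
  have hGM : ∀ {x}, x ∈ G → x ∈ M := fun hx => C.hT.mem_trans (h1 hx) P.2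
  refine ⟨fun hp => h1 hp, fun {p q} hp hpq => h2 _ hp _ (C.leP hpq).2 hpq, ?_, ?_⟩
  · intro p q hp hq
    obtain ⟨z, hz, h5, h6⟩ := h3 _ hp _ hq
    exact ⟨⟨z, hGM hz⟩, hz, h5, h6⟩
  · intro S hS hd
    obtain ⟨D, hD⟩ := sepM C.hM hS P
    obtain ⟨q, hq, hqD⟩ := h4 D.1 D.2 ⟨fun x hx => ((hD ⟨x, C.hT.mem_trans hx D.2⟩).1 hx).1,
      fun p hp => by
        obtain ⟨d, h5, h6⟩ := hd ⟨p, C.hT.mem_trans hp P.2⟩ hp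
        exact ⟨d.1, (hD d).2 ⟨(C.leP h5).1, h6⟩, h5⟩⟩
    exact ⟨⟨q, hGM hq⟩, hq, ((hD ⟨q, hGM hq⟩).1 hqD).2⟩

end Forcing

/-- Truth Lemma: `M[G] ⊨ φ[val(G,τ₁),…,val(G,τₙ)]` iff some `p ∈ G` forces
`φ` in the sense that every generic `H ∋ p` makes `φ` true in `M[H]`. -/
theorem truth_lemma (M : ZFSet) (hcount : M.toSet.Countable)
    (htrans : M.IsTransitive) (hmodel : ZModels M ZF)
    (P r one : ZFSet) (hforcing : ForcingNotion M P r one)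
    (n : ℕ) (φ : BF n) (τ : Fin n → ZFSet) (hτ : ∀ i, τ i ∈ M)
    (G : ZFSet) (hG : IsGeneric M r P G) :
    ZRealize (genExt M G) φ (fun i => zval G (τ i)) ↔
      ∃ p ∈ G, ∀ H : ZFSet, IsGeneric M r P H → p ∈ H →
        ZRealize (genExt M H) φ (fun i => zval H (τ i)) := by
  have C := FC.mk' hmodel htrans hforcing
  have key : ∀ H : ZFSet, IsGeneric M r P H →
      (ZRealize (genExt M H) φ (fun i => zval H (τ i)) ↔
        ∃ p : XX M, p.1 ∈ H ∧ Fc ⟨r, hforcing.2.1⟩ φ p (fun i => ⟨τ i, hτ i⟩)) := by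
    intro H hH
    have g := GC.mk' C hH
    have hm : ∀ i, zval H (τ i) ∈ genExt M H := fun i => mem_genExt.2 ⟨_, hτ i, rfl⟩
    have := fc_truth C g φ (fun e => e.elim) (fun i => ⟨τ i, hτ i⟩)
      (fun i => ⟨zval H (τ i), hm i⟩) (fun i => rfl)
    rw [← this]
    exact ⟨fun h => h hm, fun h _ => h⟩
  constructor
  · intro h
    obtain ⟨p, hp, h1⟩ := (key G hG).1 h
    exact ⟨p.1, hp, fun H hH hpH => (key H hH).2 ⟨p, hpH, h1⟩⟩
  · rintro ⟨p, hp, h⟩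
    exact h G hG hp


end CtmForcing
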